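/- Theorem 2, central-flux case (linear growth of the staggered DG operator bound in the polynomial degrees): With the notation of the context and with β = τ = 0, for all primary broken functions w, φ of degree q_u − 1 and dual broken functions v, ψ of degree q_v, B_c(w,v;φ,ψ) ≤ (c/h) · [ ((8√3+4)/3)·(q_u + q_v − 1) + (128/(√3·π))·√(q_u·(q_v+1)) ] · (c²‖w‖² + ‖v‖²)^{1/2} · (c²‖φ‖² + ‖ψ‖²)^{1/2}. -/

import Mathlib

open Polynomial

/-- Squared L² norm of a broken (piecewise polynomial) function on a periodic grid
of `N` elements each of width `h`, in local coordinates `s ∈ [0,h]`. -/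
noncomputable def brokenNormSq (N : ℕ) [NeZero N] (h : ℝ)
    (p : ZMod N → Polynomial ℝ) : ℝ :=
  ∑ j : ZMod N, ∫ s in (0:ℝ)..h, (p j).eval s ^ 2

/-- The numerical flux `H_j` of the staggered energy-based DG method, located at
the primary node `jh`, interior to the dual element `J_j`. -/
noncomputable def HfluxS (N : ℕ) [NeZero N] (h c β : ℝ)
    (w v : ZMod N → Polynomial ℝ) (j : ZMod N) : ℝ :=
  (v j).eval (h / 2) - β * c ^ 2 * ((w (j - 1)).eval h - (w j).eval 0)

/-- The numerical flux `G_j` of the staggered energy-based DG method, located at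
the primary element center `(j+1/2)h`, the shared boundary of `J_j` and `J_{j+1}`. -/
noncomputable def GfluxS (N : ℕ) [NeZero N] (h c τ : ℝ)
    (w v : ZMod N → Polynomial ℝ) (j : ZMod N) : ℝ :=
  (w j).eval (h / 2) - τ / c ^ 2 * ((v j).eval h - (v (j + 1)).eval 0)

/-- The staggered energy-based DG bilinear form `B_c(w,v;φ,ψ)`. -/
noncomputable def BformS (N : ℕ) [NeZero N] (h c β τ : ℝ)
    (w v φ ψ : ZMod N → Polynomial ℝ) : ℝ :=
  -(c ^ 2) * (∑ j : ZMod N,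
      ((∫ s in (0:ℝ)..(h / 2), (derivative (φ j)).eval s * (v j).eval (s + h / 2))
        + (∫ s in (h / 2)..h, (derivative (φ j)).eval s * (v (j + 1)).eval (s - h / 2))
        - (φ j).eval h * HfluxS N h c β w v (j + 1)
        + (φ j).eval 0 * HfluxS N h c β w v j))
    - c ^ 2 * (∑ j : ZMod N,
      ((∫ s in (0:ℝ)..(h / 2), (derivative (ψ j)).eval s * (w (j - 1)).eval (s + h / 2))
        + (∫ s in (h / 2)..h, (derivative (ψ j)).eval s * (w j).eval (s - h / 2))
        - (ψ j).eval h * GfluxS N h c τ w v j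
        + (ψ j).eval 0 * GfluxS N h c τ w v (j - 1)))

/-- Coefficients of the shifted Legendre polynomial on `[0,h]`. -/
noncomputable def legCoef (h : ℝ) (n k : ℕ) : ℝ :=
  ∏ i ∈ Finset.range k, (-(((n : ℝ) - i) * (n + i + 1)) / (h * ((i : ℝ) + 1) ^ 2))

/-- The shifted Legendre polynomial on `[0,h]`. -/
noncomputable def legPoly (h : ℝ) (n : ℕ) : Polynomial ℝ :=
  ∑ k ∈ Finset.range (n + 1), Polynomial.monomial k (legCoef h n k)

lemma legCoef_succ (h : ℝ) (hh : 0 < h) (n k : ℕ) :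
    h * ((k : ℝ) + 1) ^ 2 * legCoef h n (k + 1) = -(((n : ℝ) - k) * (n + k + 1)) * legCoef h n k := by
  rw [legCoef, Finset.prod_range_succ, ← legCoef]
  have : ((k : ℝ) + 1) ≠ 0 := by positivity
  field_simp

lemma legCoef_zero (h : ℝ) (n k : ℕ) (hk : n < k) : legCoef h n k = 0 := by
  rw [legCoef]
  apply Finset.prod_eq_zero (Finset.mem_range.2 hk)
  simp

lemma legCoef_ne (h : ℝ) (hh : 0 < h) (n k : ℕ) (hk : k ≤ n) : legCoef h n k ≠ 0 := by
  rw [legCoef, Finset.prod_ne_zero_iff]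
  intro i hi
  have hi' : (i : ℝ) < n := by
    have := Finset.mem_range.1 hi
    exact_mod_cast lt_of_lt_of_le this hk
  have h1 : (n : ℝ) - i ≠ 0 := by linarith
  have h2 : (n : ℝ) + i + 1 ≠ 0 := by positivity
  have h3 : (i : ℝ) + 1 ≠ 0 := by positivity
  apply div_ne_zero
  · exact neg_ne_zero.2 (mul_ne_zero h1 h2)
  · exact mul_ne_zero hh.ne' (pow_ne_zero _ h3)

lemma legPoly_coeff (h : ℝ) (n k : ℕ) : (legPoly h n).coeff k = legCoef h n k := by
  rw [legPoly, Polynomial.finsetSum_coeff]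
  simp only [Polynomial.coeff_monomial]
  rw [Finset.sum_ite_eq']
  split_ifs with hk
  · rfl
  · rw [legCoef_zero]
    simpa [Nat.lt_succ_iff] using hk

lemma legPoly_eq (h : ℝ) (hh : 0 < h) (n : ℕ) :
    derivative (X * (C h - X) * derivative (legPoly h n))
      = C (-((n : ℝ) * (n + 1))) * legPoly h n := by
  have e : X * (C h - X) * derivative (legPoly h n)
      = C h * (X * derivative (legPoly h n)) - X * (X * derivative (legPoly h n)) := by ring
  rw [e]
  ext k
  rw [Polynomial.coeff_derivative, Polynomial.coeff_sub, Polynomial.coeff_C_mul,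
    Polynomial.coeff_C_mul, Polynomial.coeff_X_mul, Polynomial.coeff_X_mul,
    Polynomial.coeff_derivative, legPoly_coeff, legPoly_coeff]
  have h1 := legCoef_succ h hh n k
  rcases k with _ | k
  · simp at h1 ⊢
    linarith
  · rw [Polynomial.coeff_X_mul, Polynomial.coeff_derivative, legPoly_coeff]
    push_cast at h1 ⊢
    linarith

lemma legPoly_natDegree (h : ℝ) (n : ℕ) : (legPoly h n).natDegree ≤ n := by
  rw [Polynomial.natDegree_le_iff_coeff_eq_zero]
  intro k hk
  rw [legPoly_coeff, legCoef_zero _ _ _ hk]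

/-- Integral of a polynomial over `[0,h]`. -/
noncomputable def pInt (h : ℝ) (p : Polynomial ℝ) : ℝ := ∫ s in (0:ℝ)..h, p.eval s

lemma pInt_add (h : ℝ) (p q : Polynomial ℝ) : pInt h (p + q) = pInt h p + pInt h q := by
  simp only [pInt, Polynomial.eval_add]
  exact intervalIntegral.integral_add (p.continuous.intervalIntegrable _ _)
    (q.continuous.intervalIntegrable _ _)

lemma pInt_C_mul (h a : ℝ) (p : Polynomial ℝ) : pInt h (C a * p) = a * pInt h p := by
  simp [pInt]

lemma pInt_nonneg (h : ℝ) (hh : 0 < h) (p : Polynomial ℝ) (hp : ∀ s ∈ Set.Icc 0 h, 0 ≤ p.eval s) :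
    0 ≤ pInt h p :=
  intervalIntegral.integral_nonneg hh.le hp

lemma pInt_deriv (h : ℝ) (p : Polynomial ℝ) : pInt h (derivative p) = p.eval h - p.eval 0 := by
  rw [pInt]
  exact intervalIntegral.integral_eq_sub_of_hasDerivAt (fun x _ => p.hasDerivAt x)
    ((derivative p).continuous.intervalIntegrable _ _)

lemma leg_pair (h : ℝ) (hh : 0 < h) (n : ℕ) (g : Polynomial ℝ) :
    pInt h (X * (C h - X) * derivative (legPoly h n) * derivative g)
      = (n : ℝ) * (n + 1) * pInt h (legPoly h n * g) := by
  have h1 := pInt_deriv h (X * (C h - X) * derivative (legPoly h n) * g)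
  rw [Polynomial.derivative_mul, legPoly_eq h hh, pInt_add, mul_assoc (C _), pInt_C_mul] at h1
  simp at h1
  linarith

lemma weighted_markov (h : ℝ) (hh : 0 < h) (n : ℕ) : ∀ f : Polynomial ℝ, f.natDegree ≤ n →
    pInt h (X * (C h - X) * derivative f ^ 2) ≤ (n : ℝ) * (n + 1) * pInt h (f ^ 2) := by
  induction n with
  | zero =>
    intro f hf
    have : derivative f = 0 := Polynomial.derivative_of_natDegree_zero (by omega)
    simp [this, pInt]
  | succ n ih =>
    intro f hf
    set P := legPoly h (n + 1) with hP
    set a : ℝ := f.coeff (n + 1) / legCoef h (n + 1) (n + 1) with ha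
    set g : Polynomial ℝ := f - C a * P with hg
    have hgd : g.natDegree ≤ n := by
      rw [Polynomial.natDegree_le_iff_coeff_eq_zero]
      intro k hk
      rw [hg, Polynomial.coeff_sub, Polynomial.coeff_C_mul, hP, legPoly_coeff]
      rcases Nat.lt_or_ge (n + 1) k with h1 | h1
      · rw [legCoef_zero _ _ _ h1, Polynomial.coeff_eq_zero_of_natDegree_lt (by omega)]
        simp
      · have : k = n + 1 := by omega
        subst this
        rw [ha, div_mul_cancel₀ _ (legCoef_ne h hh _ _ le_rfl), sub_self]
    have hfg : f = C a * P + g := by rw [hg]; ring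
    have ih' := ih g hgd
    have h1 := leg_pair h hh (n + 1) P
    have h2 := leg_pair h hh (n + 1) g
    rw [← hP] at h1 h2
    have hpos : 0 ≤ pInt h (g ^ 2) := by
      apply pInt_nonneg h hh
      intro s _
      rw [Polynomial.eval_pow]
      positivity
    have e1 : X * (C h - X) * derivative f ^ 2
        = C (a ^ 2) * (X * (C h - X) * derivative P * derivative P)
          + (C (2 * a) * (X * (C h - X) * derivative P * derivative g)
          + X * (C h - X) * derivative g ^ 2) := by
      rw [hfg]
      simp only [Polynomial.derivative_add, Polynomial.derivative_C_mul, Polynomial.C_mul,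
        Polynomial.C_pow, Polynomial.C_ofNat]
      ring
    have e2 : f ^ 2 = C (a ^ 2) * (P * P) + (C (2 * a) * (P * g) + g ^ 2) := by
      rw [hfg]
      simp only [Polynomial.C_mul, Polynomial.C_pow, Polynomial.C_ofNat]
      ring
    rw [e1, e2]
    simp only [pInt_add, pInt_C_mul]
    rw [h1, h2]
    push_cast
    have h3 : (n : ℝ) * (n + 1) * pInt h (g ^ 2) ≤ ((n : ℝ) + 1) * (n + 1 + 1) * pInt h (g ^ 2) := by
      apply mul_le_mul_of_nonneg_right _ hpos
      have : (0 : ℝ) ≤ n := Nat.cast_nonneg n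
      nlinarith
    linarith

/-- Left half local energy. -/
noncomputable def F0 (h m l : ℝ) (p : Polynomial ℝ) : ℝ :=
  ∫ s in (0:ℝ)..(h/2), (h / (4 * m) * (2 * s / h * (derivative p).eval s) ^ 2
    + (l + 1) / h * p.eval s ^ 2)

/-- Right half local energy. -/
noncomputable def F1 (h m l : ℝ) (p : Polynomial ℝ) : ℝ :=
  ∫ s in (h/2)..h, (h / (4 * m) * (2 * (h - s) / h * (derivative p).eval s) ^ 2
    + (l + 1) / h * p.eval s ^ 2)

lemma F_bound (h : ℝ) (hh : 0 < h) (n : ℕ) (m l : ℝ) (hm : m = n + 1) (p : Polynomial ℝ)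
    (hp : p.natDegree ≤ n) :
    F0 h m l p + F1 h m l p ≤ (m + l + 1) / h * ∫ s in (0:ℝ)..h, p.eval s ^ 2 := by
  have hm0 : 0 < m := by rw [hm]; positivity
  set G : ℝ → ℝ := fun s => 1 / (h * m) * (X * (C h - X) * derivative p ^ 2).eval s
    + (l + 1) / h * p.eval s ^ 2 with hG
  have hGc : Continuous G := by rw [hG]; fun_prop
  have b0 : F0 h m l p ≤ ∫ s in (0:ℝ)..(h/2), G s := by
    rw [F0]
    apply intervalIntegral.integral_mono_on (by linarith)
    · apply Continuous.intervalIntegrable; fun_prop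
    · exact hGc.intervalIntegrable _ _
    · rintro s ⟨hs0, hs1⟩
      simp only [hG, eval_mul, eval_X, eval_sub, eval_C, eval_pow]
      have : h / (4 * m) * (2 * s / h * (derivative p).eval s) ^ 2
        = 1 / (h * m) * (s * s * (derivative p).eval s ^ 2) := by field_simp; ring
      rw [this]
      gcongr
      linarith
  have b1 : F1 h m l p ≤ ∫ s in (h/2)..h, G s := by
    rw [F1]
    apply intervalIntegral.integral_mono_on (by linarith)
    · apply Continuous.intervalIntegrable; fun_prop
    · exact hGc.intervalIntegrable _ _
    · rintro s ⟨hs0, hs1⟩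
      simp only [hG, eval_mul, eval_X, eval_sub, eval_C, eval_pow]
      have : h / (4 * m) * (2 * (h - s) / h * (derivative p).eval s) ^ 2
        = 1 / (h * m) * ((h - s) * (h - s) * (derivative p).eval s ^ 2) := by field_simp; ring
      rw [this]
      have h2 : 0 ≤ h - s := by linarith
      gcongr
      linarith
  have hadd : (∫ s in (0:ℝ)..(h/2), G s) + ∫ s in (h/2)..h, G s = ∫ s in (0:ℝ)..h, G s :=
    intervalIntegral.integral_add_adjacent_intervals (hGc.intervalIntegrable _ _)
      (hGc.intervalIntegrable _ _)
  have hsplit : ∫ s in (0:ℝ)..h, G s = 1 / (h * m) * pInt h (X * (C h - X) * derivative p ^ 2)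
      + (l + 1) / h * ∫ s in (0:ℝ)..h, p.eval s ^ 2 := by
    rw [hG, intervalIntegral.integral_add, intervalIntegral.integral_const_mul,
      intervalIntegral.integral_const_mul, pInt]
    · apply Continuous.intervalIntegrable; fun_prop
    · apply Continuous.intervalIntegrable; fun_prop
  have hE : pInt h (p ^ 2) = ∫ s in (0:ℝ)..h, p.eval s ^ 2 := by simp [pInt]
  have hE0 : 0 ≤ ∫ s in (0:ℝ)..h, p.eval s ^ 2 :=
    intervalIntegral.integral_nonneg hh.le (fun s _ => by positivity)
  have hmk := weighted_markov h hh n p hp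
  rw [hE] at hmk
  set E := ∫ s in (0:ℝ)..h, p.eval s ^ 2
  have h3 : 1 / (h * m) * pInt h (X * (C h - X) * derivative p ^ 2) ≤ 1 / (h * m) * (m * m * E) := by
    apply mul_le_mul_of_nonneg_left _ (by positivity)
    refine hmk.trans (mul_le_mul_of_nonneg_right ?_ hE0)
    rw [hm]
    have : (0 : ℝ) ≤ n := Nat.cast_nonneg n
    nlinarith
  have h4 : 1 / (h * m) * (m * m * E) = m / h * E := by field_simp
  have h5 : (m + l + 1) / h * E = m / h * E + (l + 1) / h * E := by ring
  linarith

lemma young (t κ x y : ℝ) (ht : 0 < t) (hk : 0 < κ) :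
    |x * y| ≤ t * (1 / (2 * κ) * x ^ 2) + 1 / t * (κ / 2 * y ^ 2) := by
  have h1 : t * (1 / (2 * κ) * x ^ 2) + 1 / t * (κ / 2 * y ^ 2) - x * y
      = (t * x - κ * y) ^ 2 / (2 * κ * t) := by field_simp; ring
  have h2 : t * (1 / (2 * κ) * x ^ 2) + 1 / t * (κ / 2 * y ^ 2) + x * y
      = (t * x + κ * y) ^ 2 / (2 * κ * t) := by field_simp; ring
  have h3 : 0 ≤ (t * x - κ * y) ^ 2 / (2 * κ * t) := by positivity
  have h4 : 0 ≤ (t * x + κ * y) ^ 2 / (2 * κ * t) := by positivity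
  rw [abs_le]
  constructor <;> linarith

/-- Pointwise Young inequality; `a,b` values, `da`, `db` weighted derivatives. -/
lemma pointwise (h t M L a da b db σ : ℝ) (hh : 0 < h) (ht : 0 < t) (hM : 0 < M) (hL : 0 < L)
    (hσ : |σ| = 1) :
    -(da * b - a * db + σ * (2 / h * (a * b))) ≤
      t * (h / (4 * M) * da ^ 2 + (L + 1) / h * a ^ 2)
      + 1 / t * (h / (4 * L) * db ^ 2 + (M + 1) / h * b ^ 2) := by
  have h1 := young t (2 * M / h) da b ht (by positivity)
  have h2 := young t (h / (2 * L)) a db ht (by positivity)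
  have h3 := young t 1 a b ht (by positivity)
  have e1 := neg_abs_le (da * b)
  have e2 := le_abs_self (a * db)
  have e3 : -(σ * (2 / h * (a * b))) ≤ 2 / h * |a * b| := by
    calc _ ≤ |σ * (2 / h * (a * b))| := neg_le_abs _
      _ = 2 / h * |a * b| := by rw [abs_mul, hσ, abs_mul, abs_of_pos (by positivity : 0 < 2 / h)]; ring
  have h3' := mul_le_mul_of_nonneg_left h3 (by positivity : 0 ≤ 2 / h)
  have key : t * (h / (4 * M) * da ^ 2 + (L + 1) / h * a ^ 2)
      + 1 / t * (h / (4 * L) * db ^ 2 + (M + 1) / h * b ^ 2)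
      = (t * (1 / (2 * (2 * M / h)) * da ^ 2) + 1 / t * (2 * M / h / 2 * b ^ 2))
      + (t * (1 / (2 * (h / (2 * L))) * a ^ 2) + 1 / t * (h / (2 * L) / 2 * db ^ 2))
      + 2 / h * (t * (1 / (2 * 1) * a ^ 2) + 1 / t * (1 / 2 * b ^ 2)) := by
    field_simp
    ring
  rw [key]
  linarith

lemma left_bound (h t M L : ℝ) (hh : 0 < h) (ht : 0 < t) (hM : 0 < M) (hL : 0 < L)
    (a b : Polynomial ℝ) :
    -((∫ s in (0:ℝ)..(h / 2), (derivative a).eval s * b.eval (s + h / 2))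
      + a.eval 0 * b.eval (h / 2)) ≤ t * F0 h M L a + 1 / t * F1 h L M b := by
  have hder : ∀ s : ℝ, HasDerivAt (fun s => (1 - 2 * s / h) * (a.eval s * b.eval (s + h / 2)))
      (-(2 / h) * (a.eval s * b.eval (s + h / 2)) + (1 - 2 * s / h) *
        ((derivative a).eval s * b.eval (s + h / 2) + a.eval s * (derivative b).eval (s + h / 2))) s := by
    intro s
    have h1 : HasDerivAt (fun s : ℝ => 1 - 2 * s / h) (-(2 / h)) s := by
      have := (((hasDerivAt_id s).const_mul 2).div_const h).const_sub 1
      simpa using this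
    have h2 : HasDerivAt (fun s : ℝ => b.eval (s + h / 2)) ((derivative b).eval (s + h / 2)) s :=
      (b.hasDerivAt (s + h / 2)).comp_add_const s (h / 2)
    exact h1.mul ((a.hasDerivAt s).mul h2)
  have hftc := intervalIntegral.integral_eq_sub_of_hasDerivAt (a := 0) (b := h / 2)
    (fun x _ => hder x) (by apply Continuous.intervalIntegrable; fun_prop)
  have hz : 1 - 2 * (h / 2) / h = 0 := by field_simp; ring
  simp only [hz] at hftc
  simp only [zero_mul, mul_zero, zero_div, sub_zero, one_mul, zero_add, zero_sub] at hftc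
  have hF1 : F1 h L M b = ∫ s in (0:ℝ)..(h/2),
      (h / (4 * L) * ((1 - 2 * s / h) * (derivative b).eval (s + h / 2)) ^ 2
        + (M + 1) / h * b.eval (s + h / 2) ^ 2) := by
    have := intervalIntegral.integral_comp_add_right (a := 0) (b := h / 2) (fun s =>
      (h / (4 * L) * (2 * (h - s) / h * (derivative b).eval s) ^ 2
        + (M + 1) / h * b.eval s ^ 2)) (h / 2)
    rw [zero_add, add_halves] at this
    rw [F1, ← this]
    congr 1
    ext s
    have : 2 * (h - (s + h / 2)) / h = 1 - 2 * s / h := by field_simp; ring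
    rw [this]
  rw [hF1, F0, ← intervalIntegral.integral_const_mul, ← intervalIntegral.integral_const_mul,
    ← intervalIntegral.integral_add (by apply Continuous.intervalIntegrable; fun_prop)
      (by apply Continuous.intervalIntegrable; fun_prop)]
  have hab : a.eval 0 * b.eval (h / 2) = -∫ s in (0:ℝ)..(h/2), (-(2 / h) * (a.eval s * b.eval (s + h / 2)) + (1 - 2 * s / h) *
        ((derivative a).eval s * b.eval (s + h / 2) + a.eval s * (derivative b).eval (s + h / 2))) := by
    rw [hftc]; ring
  rw [hab, ← sub_eq_add_neg, ← intervalIntegral.integral_sub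
    (by apply Continuous.intervalIntegrable; fun_prop)
      (by apply Continuous.intervalIntegrable; fun_prop), ← intervalIntegral.integral_neg]
  apply intervalIntegral.integral_mono_on (by linarith)
    (by apply Continuous.intervalIntegrable; fun_prop)
    (by apply Continuous.intervalIntegrable; fun_prop)
  intro s _
  have := pointwise h t M L (a.eval s) (2 * s / h * (derivative a).eval s) (b.eval (s + h / 2))
    ((1 - 2 * s / h) * (derivative b).eval (s + h / 2)) 1 hh ht hM hL (by simp)
  refine le_trans (le_of_eq ?_) this
  ring

lemma right_bound (h t M L : ℝ) (hh : 0 < h) (ht : 0 < t) (hM : 0 < M) (hL : 0 < L)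
    (a b : Polynomial ℝ) :
    -((∫ s in (h / 2)..h, (derivative a).eval s * b.eval (s - h / 2))
      - a.eval h * b.eval (h / 2)) ≤ t * F1 h M L a + 1 / t * F0 h L M b := by
  have hder : ∀ s : ℝ, HasDerivAt (fun s => (2 * s / h - 1) * (a.eval s * b.eval (s - h / 2)))
      ((2 / h) * (a.eval s * b.eval (s - h / 2)) + (2 * s / h - 1) *
        ((derivative a).eval s * b.eval (s - h / 2) + a.eval s * (derivative b).eval (s - h / 2))) s := by
    intro s
    have h1 : HasDerivAt (fun s : ℝ => 2 * s / h - 1) (2 / h) s := by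
      have := (((hasDerivAt_id s).const_mul 2).div_const h).sub_const 1
      simpa using this
    have h2 : HasDerivAt (fun s : ℝ => b.eval (s - h / 2)) ((derivative b).eval (s - h / 2)) s :=
      (b.hasDerivAt (s - h / 2)).comp_sub_const s (h / 2)
    exact h1.mul ((a.hasDerivAt s).mul h2)
  have hftc := intervalIntegral.integral_eq_sub_of_hasDerivAt (a := h / 2) (b := h)
    (fun x _ => hder x) (by apply Continuous.intervalIntegrable; fun_prop)
  have hz : 2 * (h / 2) / h - 1 = 0 := by field_simp; ring
  have hz1 : 2 * h / h - 1 = 1 := by field_simp; ring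
  have hz2 : h - h / 2 = h / 2 := by ring
  simp only [hz, hz1, hz2] at hftc
  simp only [zero_mul, sub_zero, one_mul] at hftc
  have hF0 : F0 h L M b = ∫ s in (h/2)..h,
      (h / (4 * L) * ((2 * s / h - 1) * (derivative b).eval (s - h / 2)) ^ 2
        + (M + 1) / h * b.eval (s - h / 2) ^ 2) := by
    have := intervalIntegral.integral_comp_sub_right (a := h / 2) (b := h) (fun s =>
      (h / (4 * L) * (2 * s / h * (derivative b).eval s) ^ 2
        + (M + 1) / h * b.eval s ^ 2)) (h / 2)
    rw [sub_self, hz2] at this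
    rw [F0, ← this]
    congr 1
    ext s
    have : 2 * (s - h / 2) / h = 2 * s / h - 1 := by field_simp
    rw [this]
  rw [hF0, F1, ← intervalIntegral.integral_const_mul, ← intervalIntegral.integral_const_mul,
    ← intervalIntegral.integral_add (by apply Continuous.intervalIntegrable; fun_prop)
      (by apply Continuous.intervalIntegrable; fun_prop)]
  rw [← hftc, ← intervalIntegral.integral_sub
    (by apply Continuous.intervalIntegrable; fun_prop)
      (by apply Continuous.intervalIntegrable; fun_prop), ← intervalIntegral.integral_neg]
  apply intervalIntegral.integral_mono_on (by linarith)
    (by apply Continuous.intervalIntegrable; fun_prop)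
    (by apply Continuous.intervalIntegrable; fun_prop)
  intro s _
  have := pointwise h t M L (a.eval s) (2 * (h - s) / h * (derivative a).eval s) (b.eval (s - h / 2))
    ((2 * s / h - 1) * (derivative b).eval (s - h / 2)) (-1) hh ht hM hL (by simp)
  refine le_trans (le_of_eq ?_) this
  have : 2 * (h - s) / h = 1 - (2 * s / h - 1) := by field_simp; ring
  rw [this]
  ring

lemma optimise (x e1 e2 : ℝ) (h1 : 0 ≤ e1) (h2 : 0 ≤ e2)
    (H : ∀ r : ℝ, 0 < r → x ≤ r * e2 + 1 / r * e1) : x ≤ 2 * Real.sqrt e1 * Real.sqrt e2 := by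
  set p := Real.sqrt e1 with hp
  set q := Real.sqrt e2 with hq
  have hp0 : 0 ≤ p := Real.sqrt_nonneg _
  have hq0 : 0 ≤ q := Real.sqrt_nonneg _
  have ep : e1 = p * p := (Real.mul_self_sqrt h1).symm
  have eq : e2 = q * q := (Real.mul_self_sqrt h2).symm
  have key : ∀ ε : ℝ, 0 < ε → x ≤ 2 * p * q + ε * (p + q) := by
    intro ε hε
    have := H ((p + ε) / (q + ε)) (by positivity)
    have a1 : (p + ε) / (q + ε) * e2 ≤ (p + ε) * q := by
      rw [eq, div_mul_eq_mul_div, div_le_iff₀ (by positivity)]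
      have : 0 ≤ (p + ε) * q * ε := by positivity
      nlinarith
    have a2 : 1 / ((p + ε) / (q + ε)) * e1 ≤ (q + ε) * p := by
      rw [ep, one_div_div, div_mul_eq_mul_div, div_le_iff₀ (by positivity)]
      have : 0 ≤ (q + ε) * p * ε := by positivity
      nlinarith
    linarith
  apply le_of_forall_pos_le_add
  intro δ hδ
  have h3 := key (δ / (p + q + 1)) (by positivity)
  have h4 : δ / (p + q + 1) * (p + q) ≤ δ := by
    rw [div_mul_eq_mul_div, div_le_iff₀ (by positivity)]
    nlinarith
  linarith

lemma brokenNormSq_nonneg (N : ℕ) [NeZero N] (h : ℝ) (hh : 0 < h) (p : ZMod N → Polynomial ℝ) :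
    0 ≤ brokenNormSq N h p :=
  Finset.sum_nonneg (fun _ _ => intervalIntegral.integral_nonneg hh.le (fun s _ => by positivity))

lemma sum_F (N : ℕ) [NeZero N] (h : ℝ) (hh : 0 < h) (n : ℕ) (m l : ℝ) (hm : m = n + 1)
    (p : ZMod N → Polynomial ℝ) (hp : ∀ j, (p j).natDegree ≤ n) :
    ∑ j, F0 h m l (p j) + ∑ j, F1 h m l (p j) ≤ (m + l + 1) / h * brokenNormSq N h p := by
  rw [← Finset.sum_add_distrib, brokenNormSq, Finset.mul_sum]
  exact Finset.sum_le_sum (fun j _ => F_bound h hh n m l hm (p j) (hp j))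

/-- Theorem 2, central-flux case (`β = τ = 0`): linear growth of the staggered DG
operator bound in the polynomial degrees. -/
theorem staggered_operator_bound_central_flux
    (N : ℕ) [NeZero N] (hN : 1 ≤ N) (h c : ℝ) (hh : 0 < h) (hc : 0 < c)
    (qu qv : ℕ) (hqu : 1 ≤ qu)
    (w φ v ψ : ZMod N → Polynomial ℝ)
    (hw : ∀ j, (w j).natDegree ≤ qu - 1) (hφ : ∀ j, (φ j).natDegree ≤ qu - 1)
    (hv : ∀ j, (v j).natDegree ≤ qv) (hψ : ∀ j, (ψ j).natDegree ≤ qv) :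
    BformS N h c 0 0 w v φ ψ ≤
      c / h * ((8 * Real.sqrt 3 + 4) / 3 * ((qu : ℝ) + (qv : ℝ) - 1)
          + 128 / (Real.sqrt 3 * Real.pi) * Real.sqrt ((qu : ℝ) * ((qv : ℝ) + 1)))
        * Real.sqrt (c ^ 2 * brokenNormSq N h w + brokenNormSq N h v)
        * Real.sqrt (c ^ 2 * brokenNormSq N h φ + brokenNormSq N h ψ) := by
  obtain ⟨n, rfl⟩ : ∃ n, qu = n + 1 := ⟨qu - 1, by omega⟩
  simp only [Nat.add_sub_cancel] at hw hφ
  set M : ℝ := (n : ℝ) + 1 with hM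
  set L : ℝ := (qv : ℝ) + 1 with hL
  have hM0 : 0 < M := by positivity
  have hL0 : 0 < L := by positivity
  have hW := brokenNormSq_nonneg N h hh w
  have hV := brokenNormSq_nonneg N h hh v
  have hΦ := brokenNormSq_nonneg N h hh φ
  have hΨ := brokenNormSq_nonneg N h hh ψ
  have main : ∀ r : ℝ, 0 < r → BformS N h c 0 0 w v φ ψ / (c * ((M + L + 1) / h)) ≤
      r * (c ^ 2 * brokenNormSq N h φ + brokenNormSq N h ψ)
        + 1 / r * (c ^ 2 * brokenNormSq N h w + brokenNormSq N h v) := by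
    intro r hr
    have hA : ∑ j : ZMod N, -((∫ s in (0:ℝ)..(h / 2), (derivative (φ j)).eval s * (v j).eval (s + h / 2))
        + (∫ s in (h / 2)..h, (derivative (φ j)).eval s * (v (j + 1)).eval (s - h / 2))
        - (φ j).eval h * (v (j + 1)).eval (h / 2)
        + (φ j).eval 0 * (v j).eval (h / 2)) ≤
        (c * r) * ((M + L + 1) / h * brokenNormSq N h φ)
          + 1 / (c * r) * ((L + M + 1) / h * brokenNormSq N h v) := by
      have h1 := sum_F N h hh n M L hM φ hφ
      have h2 := sum_F N h hh qv L M hL v hv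
      have h3 : ∑ j, F0 h L M (v (j + 1)) = ∑ j, F0 h L M (v j) :=
        Equiv.sum_comp (Equiv.addRight (1 : ZMod N)) (fun j => F0 h L M (v j))
      have hcr : 0 < c * r := by positivity
      refine le_trans ?_ (add_le_add (mul_le_mul_of_nonneg_left h1 hcr.le)
        (mul_le_mul_of_nonneg_left h2 (by positivity : 0 ≤ 1 / (c * r))))
      rw [← h3, ← Finset.sum_add_distrib, ← Finset.sum_add_distrib, Finset.mul_sum,
        Finset.mul_sum, ← Finset.sum_add_distrib]
      apply Finset.sum_le_sum
      intro j _
      have l1 := left_bound h (c * r) M L hh hcr hM0 hL0 (φ j) (v j)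
      have l2 := right_bound h (c * r) M L hh hcr hM0 hL0 (φ j) (v (j + 1))
      linarith
    have hC : ∑ j : ZMod N, -((∫ s in (0:ℝ)..(h / 2), (derivative (ψ j)).eval s * (w (j - 1)).eval (s + h / 2))
        + (∫ s in (h / 2)..h, (derivative (ψ j)).eval s * (w j).eval (s - h / 2))
        - (ψ j).eval h * (w j).eval (h / 2)
        + (ψ j).eval 0 * (w (j - 1)).eval (h / 2)) ≤
        (r / c) * ((L + M + 1) / h * brokenNormSq N h ψ)
          + 1 / (r / c) * ((M + L + 1) / h * brokenNormSq N h w) := by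
      have h1 := sum_F N h hh n M L hM w hw
      have h2 := sum_F N h hh qv L M hL ψ hψ
      have h3 : ∑ j, F1 h M L (w (j - 1)) = ∑ j, F1 h M L (w j) :=
        Equiv.sum_comp (Equiv.subRight (1 : ZMod N)) (fun j => F1 h M L (w j))
      have hcr : 0 < r / c := by positivity
      refine le_trans ?_ (add_le_add (mul_le_mul_of_nonneg_left h2 hcr.le)
        (mul_le_mul_of_nonneg_left h1 (by positivity : 0 ≤ 1 / (r / c))))
      rw [← h3, ← Finset.sum_add_distrib, ← Finset.sum_add_distrib, Finset.mul_sum,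
        Finset.mul_sum, ← Finset.sum_add_distrib]
      apply Finset.sum_le_sum
      intro j _
      have l1 := left_bound h (r / c) L M hh hcr hL0 hM0 (ψ j) (w (j - 1))
      have l2 := right_bound h (r / c) L M hh hcr hL0 hM0 (ψ j) (w j)
      linarith
    rw [Finset.sum_neg_distrib] at hA hC
    rw [div_le_iff₀ (by positivity)]
    have hc2 : 0 ≤ c ^ 2 := by positivity
    have hA' := mul_le_mul_of_nonneg_left hA hc2
    have hC' := mul_le_mul_of_nonneg_left hC hc2
    simp only [BformS, HfluxS, GfluxS, zero_mul, zero_div, sub_zero]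
    have e : (r * (c ^ 2 * brokenNormSq N h φ + brokenNormSq N h ψ)
        + 1 / r * (c ^ 2 * brokenNormSq N h w + brokenNormSq N h v)) * (c * ((M + L + 1) / h))
        = c ^ 2 * ((c * r) * ((M + L + 1) / h * brokenNormSq N h φ)
          + 1 / (c * r) * ((L + M + 1) / h * brokenNormSq N h v))
        + c ^ 2 * ((r / c) * ((L + M + 1) / h * brokenNormSq N h ψ)
          + 1 / (r / c) * ((M + L + 1) / h * brokenNormSq N h w)) := by
      field_simp
      ring
    rw [e]
    linarith
  have hopt := optimise _ _ _ (by positivity) (by positivity) main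
  rw [div_le_iff₀ (by positivity)] at hopt
  refine hopt.trans ?_
  have hs3 : Real.sqrt 3 ≤ 2 := Real.sqrt_le_iff.2 ⟨by norm_num, by norm_num⟩
  have hs3' : 1 ≤ Real.sqrt 3 := Real.one_le_sqrt.2 (by norm_num)
  have hpi := Real.pi_le_four
  have hpi0 := Real.pi_pos
  have hn0 : (0 : ℝ) ≤ n := Nat.cast_nonneg n
  have hq0 : (0 : ℝ) ≤ qv := Nat.cast_nonneg qv
  have k1 : 16 ≤ 128 / (Real.sqrt 3 * Real.pi) := by
    rw [le_div_iff₀ (by positivity)]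
    nlinarith
  have k2 : 1 ≤ Real.sqrt (((n + 1 : ℕ) : ℝ) * L) := by
    rw [Real.one_le_sqrt]
    push_cast
    nlinarith
  have k3 : 2 * (M + L + 1) ≤ (8 * Real.sqrt 3 + 4) / 3 * (((n + 1 : ℕ) : ℝ) + (qv : ℝ) - 1)
          + 128 / (Real.sqrt 3 * Real.pi) * Real.sqrt (((n + 1 : ℕ) : ℝ) * L) := by
    have a1 : 16 * 1 ≤ 128 / (Real.sqrt 3 * Real.pi) * Real.sqrt (((n + 1 : ℕ) : ℝ) * L) :=
      mul_le_mul k1 k2 (by norm_num) (by positivity)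
    have a2 : 2 * (((n + 1 : ℕ) : ℝ) + (qv : ℝ) - 1)
        ≤ (8 * Real.sqrt 3 + 4) / 3 * (((n + 1 : ℕ) : ℝ) + (qv : ℝ) - 1) := by
      apply mul_le_mul_of_nonneg_right (by linarith)
      push_cast
      linarith
    push_cast at a1 a2 ⊢
    linarith
  have hS := mul_nonneg (Real.sqrt_nonneg (c ^ 2 * brokenNormSq N h w + brokenNormSq N h v))
    (Real.sqrt_nonneg (c ^ 2 * brokenNormSq N h φ + brokenNormSq N h ψ))
  have k4 := mul_le_mul_of_nonneg_right (mul_le_mul_of_nonneg_left k3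
    (by positivity : 0 ≤ c / h)) hS
  refine le_trans (le_of_eq ?_) (k4.trans (le_of_eq ?_))
  · ring
  · ring
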